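/- arXiv:2312.02874 — 3 statements merged into one kernel-verified Lean document; each statement's English description precedes it below -/
import Mathlib

section
/- For every integer n ≥ 1 and every x > 0, (4n²/(4n²+1)) · x/(n²+x²) ≤ φ_n(x) ≤ (4n²/(4n²-1)) · x/(n²+x²). -/
open Real

/-- The universal function `φ_n`. -/
noncomputable def phi (n : ℕ) (x : ℝ) : ℝ :=
  ∫ η in (0:ℝ)..π, Real.exp (-2 * x * Real.sin η) * Real.cos (2 * n * η)

/-- Maximum principle on the half line. -/
lemma aux_max (w dw ddw : ℝ → ℝ) (m : ℝ) (hc : Continuous w) (h0 : w 0 = 0)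
    (hinf : Filter.Tendsto w Filter.atTop (nhds 0))
    (h1 : ∀ x, 0 < x → HasDerivAt w (dw x) x)
    (h2 : ∀ x, 0 < x → HasDerivAt dw (ddw x) x)
    (hm : 0 < m)
    (hD : ∀ x, 0 < x → x ^ 2 * ddw x + x * dw x ≤ 4 * (m + x ^ 2) * w x) :
    ∀ x, 0 < x → 0 ≤ w x := by
  intro a ha
  by_contra hneg
  have hneg : w a < 0 := not_le.mp hneg
  obtain ⟨R, hR⟩ := Filter.eventually_atTop.mp
    ((hinf.eventually (lt_mem_nhds hneg)).and (Filter.eventually_gt_atTop a))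
  have haR : a < R := (hR R le_rfl).2
  obtain ⟨p, hp, hmin⟩ := (isCompact_Icc (a := (0:ℝ)) (b := R)).exists_isMinOn
    ⟨a, ha.le, haR.le⟩ hc.continuousOn
  have hpa : w p ≤ w a := hmin (a := a) ⟨ha.le, haR.le⟩
  have hp0 : 0 < p := by
    rcases hp.1.lt_or_eq with h | h
    · exact h
    · rw [← h] at hpa; linarith
  have hpR : p < R := by
    rcases hp.2.lt_or_eq with h | h
    · exact h
    · have := (hR R le_rfl).1
      rw [← h] at this; linarith
  have hloc : IsLocalMin w p := hmin.isLocalMin (Icc_mem_nhds hp0 hpR)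
  have hdwp : dw p = 0 := hloc.hasDerivAt_eq_zero (h1 p hp0)
  have hddwp : ddw p < 0 := by
    have := hD p hp0
    rw [hdwp] at this
    have h3 : 4 * (m + p ^ 2) * w p < 0 := mul_neg_of_pos_of_neg (by positivity) (by linarith)
    have h4 : p ^ 2 * ddw p < 0 := by linarith
    by_contra h5
    have h5 := not_lt.mp h5
    have : 0 ≤ p ^ 2 * ddw p := by positivity
    linarith
  have hev : deriv w =ᶠ[nhds p] dw := by
    filter_upwards [lt_mem_nhds hp0] with y hy using (h1 y hy).deriv
  have hdd : deriv (deriv w) p = ddw p := by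
    rw [hev.deriv_eq]; exact (h2 p hp0).deriv
  have hmax : IsLocalMax w p := isLocalMax_of_deriv_deriv_neg (by rw [hdd]; exact hddwp)
    (by rw [(h1 p hp0).deriv]; exact hdwp) hc.continuousAt
  have hconst : w =ᶠ[nhds p] fun _ => w p := by
    filter_upwards [hloc, hmax] with y hy1 hy2 using le_antisymm hy2 hy1
  have hd : deriv w =ᶠ[nhds p] fun _ => 0 := by
    have := hconst.deriv
    simpa using this
  have : deriv (deriv w) p = 0 := by rw [hd.deriv_eq]; simp
  linarith

/-- Iterated `x`-derivatives of `phi`. -/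
noncomputable def auxG (n k : ℕ) (x : ℝ) : ℝ :=
  ∫ η in (0:ℝ)..π, (-2 * Real.sin η) ^ k * (Real.exp (-2 * x * Real.sin η) * Real.cos (2 * n * η))

lemma auxG_deriv (n k : ℕ) (x : ℝ) : HasDerivAt (auxG n k) (auxG n (k+1) x) x := by
  have := (intervalIntegral.hasDerivAt_integral_of_dominated_loc_of_deriv_le
    (μ := MeasureTheory.volume) (a := 0) (b := π)
    (F := fun x η => (-2 * Real.sin η) ^ k *
      (Real.exp (-2 * x * Real.sin η) * Real.cos (2 * n * η)))
    (F' := fun x η => (-2 * Real.sin η) ^ (k+1) *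
      (Real.exp (-2 * x * Real.sin η) * Real.cos (2 * n * η)))
    (x₀ := x) (s := Metric.ball x 1) (bound := fun _ => 2 ^ (k+1) * Real.exp (2 * (|x| + 1)))
    (Metric.ball_mem_nhds x one_pos) ?_ ?_ ?_ ?_ ?_ ?_).2
  · exact this
  · refine Filter.Eventually.of_forall fun y => ?_
    exact (Continuous.aestronglyMeasurable (by fun_prop))
  · exact Continuous.intervalIntegrable (by fun_prop) _ _
  · exact (Continuous.aestronglyMeasurable (by fun_prop))
  · refine Filter.Eventually.of_forall fun η _ y hy => ?_
    have hs : |Real.sin η| ≤ 1 := Real.abs_sin_le_one η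
    have hcs : |Real.cos (2 * n * η)| ≤ 1 := Real.abs_cos_le_one _
    have hyb : |y| ≤ |x| + 1 := by
      have h1 : |y - x| < 1 := by simpa [Real.dist_eq] using hy
      have h2 : |y| ≤ |y - x| + |x| := by simpa using abs_add_le (y - x) x
      linarith
    have he : Real.exp (-2 * y * Real.sin η) ≤ Real.exp (2 * (|x| + 1)) := by
      apply Real.exp_le_exp.mpr
      have h3 : |y * Real.sin η| ≤ |x| + 1 := by
        rw [abs_mul]
        calc |y| * |Real.sin η| ≤ |y| * 1 := by gcongr
          _ ≤ _ := by linarith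
      have := (abs_le.mp h3).1
      nlinarith
    rw [Real.norm_eq_abs, abs_mul, abs_mul, abs_pow, abs_mul, Real.abs_exp]
    have h2 : |(-2:ℝ)| = 2 := by norm_num
    rw [h2]
    have ha : (2 * |Real.sin η|) ^ (k+1) ≤ 2 ^ (k+1) := by
      apply pow_le_pow_left₀ (by positivity); linarith
    have hb : Real.exp (-2 * y * Real.sin η) * |Real.cos (2 * n * η)|
        ≤ Real.exp (2 * (|x| + 1)) * 1 := by gcongr
    rw [mul_one] at hb
    gcongr
  · exact intervalIntegrable_const
  · refine Filter.Eventually.of_forall fun η _ y hy => ?_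
    have h1 : HasDerivAt (fun y => -2 * y * Real.sin η) (-2 * Real.sin η) y := by
      have := ((hasDerivAt_id y).const_mul (-2:ℝ)).mul_const (Real.sin η)
      simpa using this
    have := ((h1.exp).mul_const (Real.cos (2 * n * η))).const_mul ((-2 * Real.sin η) ^ k)
    refine this.congr_deriv ?_
    ring

lemma aux_phi (n : ℕ) : phi n = auxG n 0 := by
  funext x; simp [phi, auxG]

lemma aux_ode (n : ℕ) (x : ℝ) :
    x ^ 2 * auxG n 2 x + x * auxG n 1 x = 4 * ((n:ℝ) ^ 2 + x ^ 2) * auxG n 0 x - 4 * x := by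
  have hF : ∀ η : ℝ, HasDerivAt (fun η => Real.exp (-2 * x * Real.sin η) *
      (-2 * x * Real.cos η * Real.cos (2 * n * η) + 2 * n * Real.sin (2 * n * η)))
      (Real.exp (-2 * x * Real.sin η) * (-2 * x * Real.cos η) *
      (-2 * x * Real.cos η * Real.cos (2 * n * η) + 2 * n * Real.sin (2 * n * η)) +
      Real.exp (-2 * x * Real.sin η) *
      ((-2 * x * (-Real.sin η)) * Real.cos (2 * n * η)
        + -2 * x * Real.cos η * (-Real.sin (2 * n * η) * (2 * n))
        + 2 * n * (Real.cos (2 * n * η) * (2 * n)))) η := by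
    intro η
    have hl : HasDerivAt (fun η : ℝ => 2 * (n:ℝ) * η) (2 * n) η := by
      simpa using (hasDerivAt_id η).const_mul (2 * (n:ℝ))
    exact ((Real.hasDerivAt_sin η).const_mul (-2 * x)).exp.mul
      ((((Real.hasDerivAt_cos η).const_mul (-2 * x)).mul hl.cos).add (hl.sin.const_mul (2 * (n:ℝ))))
  have hI := intervalIntegral.integral_eq_sub_of_hasDerivAt (a := 0) (b := π)
    (fun η _ => hF η) (Continuous.intervalIntegrable (by fun_prop) _ _)
  have hcn : Real.cos (2 * n * π) = 1 := by
    rw [show 2 * (n:ℝ) * π = n * (2 * π) by ring]; exact Real.cos_nat_mul_two_pi n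
  have hsn : Real.sin (2 * n * π) = 0 := by
    have := Real.sin_nat_mul_pi (2 * n)
    push_cast at this; exact this
  simp only [Real.sin_pi, Real.cos_pi, hcn, hsn, Real.sin_zero, Real.cos_zero, mul_zero,
    Real.exp_zero] at hI
  have hint : ∀ k, IntervalIntegrable (fun η => (-2 * Real.sin η) ^ k *
      (Real.exp (-2 * x * Real.sin η) * Real.cos (2 * n * η))) MeasureTheory.volume 0 π :=
    fun k => Continuous.intervalIntegrable (by fun_prop) _ _
  have key : 4 * ((n:ℝ) ^ 2 + x ^ 2) * auxG n 0 x - (x ^ 2 * auxG n 2 x + x * auxG n 1 x)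
      = 4 * x := by
    have e : (4 * x : ℝ) = 1 * (-2 * x * -1 * 1 + 0) - 1 * (-2 * x * 1 * 1 + 0) := by ring
    rw [e, ← hI]
    unfold auxG
    rw [← intervalIntegral.integral_const_mul, ← intervalIntegral.integral_const_mul,
      ← intervalIntegral.integral_const_mul,
      ← intervalIntegral.integral_add ((hint 2).const_mul _) ((hint 1).const_mul _),
      ← intervalIntegral.integral_sub ((hint 0).const_mul _)
        (((hint 2).const_mul _).add ((hint 1).const_mul _))]
    apply intervalIntegral.integral_congr
    intro η _
    have hsc := Real.sin_sq_add_cos_sq η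
    have hc2 : Real.cos η ^ 2 = 1 - Real.sin η ^ 2 := by linarith
    simp only
    ring_nf
    rw [hc2]
    ring
  linarith

lemma aux_zero (n : ℕ) (hn : 1 ≤ n) : auxG n 0 0 = 0 := by
  have hnz : (2 * (n:ℝ)) ≠ 0 := by positivity
  have hsn : Real.sin (2 * n * π) = 0 := by
    have := Real.sin_nat_mul_pi (2 * n)
    push_cast at this; exact this
  unfold auxG
  simp only [pow_zero, one_mul, mul_zero, zero_mul, Real.exp_zero]
  rw [intervalIntegral.integral_comp_mul_left (fun t => Real.cos t) hnz, integral_cos, hsn]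
  simp

lemma aux_inf (n : ℕ) : Filter.Tendsto (auxG n 0) Filter.atTop (nhds 0) := by
  have h := intervalIntegral.tendsto_integral_filter_of_dominated_convergence
    (μ := MeasureTheory.volume) (a := 0) (b := π) (l := Filter.atTop)
    (F := fun x η => (-2 * Real.sin η) ^ 0 *
      (Real.exp (-2 * x * Real.sin η) * Real.cos (2 * n * η)))
    (f := fun _ => 0) (fun _ => 1) ?_ ?_ ?_ ?_
  · rw [intervalIntegral.integral_zero] at h
    exact h
  · refine Filter.Eventually.of_forall fun y => ?_
    exact (Continuous.aestronglyMeasurable (by fun_prop))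
  · filter_upwards [Filter.eventually_ge_atTop 0] with x hx
    refine Filter.Eventually.of_forall fun η hη => ?_
    rw [Set.uIoc_of_le Real.pi_pos.le] at hη
    have hs := Real.sin_nonneg_of_nonneg_of_le_pi hη.1.le hη.2
    rw [pow_zero, one_mul, Real.norm_eq_abs, abs_mul, Real.abs_exp]
    have h1 : Real.exp (-2 * x * Real.sin η) ≤ 1 := by
      apply Real.exp_le_one_iff.mpr
      nlinarith [mul_nonneg hx hs]
    exact mul_le_one₀ h1 (abs_nonneg _) (Real.abs_cos_le_one _)
  · exact intervalIntegrable_const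
  · have hne : ∀ᵐ η : ℝ, η ≠ π := by
      simp [MeasureTheory.ae_iff]
    filter_upwards [hne] with η hη1 hη
    rw [Set.uIoc_of_le Real.pi_pos.le] at hη
    have hs := Real.sin_pos_of_pos_of_lt_pi hη.1 (lt_of_le_of_ne hη.2 hη1)
    have h1 : Filter.Tendsto (fun x : ℝ => Real.exp (-2 * x * Real.sin η)) Filter.atTop
        (nhds 0) := by
      apply Real.tendsto_exp_atBot.comp
      have : (fun x : ℝ => -2 * x * Real.sin η) = fun x => (-2 * Real.sin η) * x := by
        funext x; ring
      rw [this]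
      exact Filter.tendsto_id.const_mul_atTop_of_neg (by linarith)
    simpa using h1.mul_const (Real.cos (2 * n * η))

lemma aux_psi1 (m x : ℝ) (hm : 0 < m) :
    HasDerivAt (fun x => x / (m + x ^ 2)) ((m - x ^ 2) / (m + x ^ 2) ^ 2) x := by
  have hq : m + x ^ 2 ≠ 0 := by positivity
  have := (hasDerivAt_id x).div ((hasDerivAt_pow 2 x).const_add m) hq
  refine this.congr_deriv ?_
  simp only [id]
  congr 1
  push_cast
  ring

lemma aux_psi2 (m x : ℝ) (hm : 0 < m) :
    HasDerivAt (fun x => (m - x ^ 2) / (m + x ^ 2) ^ 2)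
      ((2 * x ^ 3 - 6 * m * x) / (m + x ^ 2) ^ 3) x := by
  have hq : m + x ^ 2 ≠ 0 := by positivity
  have := ((hasDerivAt_pow 2 x).const_sub m).div (((hasDerivAt_pow 2 x).const_add m).pow 2)
    (pow_ne_zero 2 hq)
  refine this.congr_deriv ?_
  simp only [Pi.pow_apply]
  field_simp
  push_cast
  ring

lemma aux_D (m x : ℝ) (hm : 0 < m) (hx : 0 < x) :
    |x ^ 2 * ((2 * x ^ 3 - 6 * m * x) / (m + x ^ 2) ^ 3) + x * ((m - x ^ 2) / (m + x ^ 2) ^ 2)|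
      ≤ x / m := by
  have hq : 0 < m + x ^ 2 := by positivity
  have e : x ^ 2 * ((2 * x ^ 3 - 6 * m * x) / (m + x ^ 2) ^ 3)
      + x * ((m - x ^ 2) / (m + x ^ 2) ^ 2)
      = x / (m + x ^ 2) * (1 - 8 * m * x ^ 2 / (m + x ^ 2) ^ 2) := by
    field_simp
    ring
  have h1 : 8 * m * x ^ 2 / (m + x ^ 2) ^ 2 ≤ 2 := by
    rw [div_le_iff₀ (by positivity)]
    nlinarith [sq_nonneg (m - x ^ 2)]
  have h2 : 0 ≤ 8 * m * x ^ 2 / (m + x ^ 2) ^ 2 := by positivity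
  rw [e, abs_mul, abs_of_pos (show 0 < x / (m + x ^ 2) by positivity)]
  have h3 : |1 - 8 * m * x ^ 2 / (m + x ^ 2) ^ 2| ≤ 1 := abs_le.mpr ⟨by linarith, by linarith⟩
  calc x / (m + x ^ 2) * |1 - 8 * m * x ^ 2 / (m + x ^ 2) ^ 2| ≤ x / (m + x ^ 2) * 1 := by gcongr
    _ = x / (m + x ^ 2) := mul_one _
    _ ≤ x / m := by
      gcongr
      nlinarith [sq_nonneg x]

lemma aux_psi_inf (m : ℝ) (hm : 0 < m) :
    Filter.Tendsto (fun x : ℝ => x / (m + x ^ 2)) Filter.atTop (nhds 0) := by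
  refine squeeze_zero' (g := fun x : ℝ => x⁻¹) ?_ ?_ tendsto_inv_atTop_zero
  · filter_upwards [Filter.eventually_gt_atTop 0] with x hx
    positivity
  · filter_upwards [Filter.eventually_gt_atTop 0] with x hx
    rw [div_le_iff₀ (by positivity)]
    have : x⁻¹ * (m + x ^ 2) = x + x⁻¹ * m := by field_simp; ring
    have h2 : 0 < x⁻¹ * m := by positivity
    linarith

/-- Comparison with a sign `σ = ±1`. -/
lemma aux_cmp (n : ℕ) (hn : 1 ≤ n) (s c : ℝ)
    (hsc : ∀ x D : ℝ, 0 < x → |D| ≤ x / (n:ℝ) ^ 2 → s * (c * D - 4 * x * (c - 1)) ≤ 0) :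
    ∀ x, 0 < x → 0 ≤ s * (c * (x / ((n:ℝ) ^ 2 + x ^ 2)) - auxG n 0 x) := by
  have hm : (0:ℝ) < (n:ℝ) ^ 2 := by positivity
  have hd1 : ∀ x : ℝ, HasDerivAt (fun x => s * (c * (x / ((n:ℝ) ^ 2 + x ^ 2)) - auxG n 0 x))
      (s * (c * (((n:ℝ) ^ 2 - x ^ 2) / ((n:ℝ) ^ 2 + x ^ 2) ^ 2) - auxG n 1 x)) x := fun x =>
    (((aux_psi1 _ x hm).const_mul c).sub (auxG_deriv n 0 x)).const_mul s
  have hd2 : ∀ x : ℝ, HasDerivAt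
      (fun x => s * (c * (((n:ℝ) ^ 2 - x ^ 2) / ((n:ℝ) ^ 2 + x ^ 2) ^ 2) - auxG n 1 x))
      (s * (c * ((2 * x ^ 3 - 6 * (n:ℝ) ^ 2 * x) / ((n:ℝ) ^ 2 + x ^ 2) ^ 3) - auxG n 2 x)) x :=
    fun x => (((aux_psi2 _ x hm).const_mul c).sub (auxG_deriv n 1 x)).const_mul s
  refine aux_max _ _ (fun x => s * (c * ((2 * x ^ 3 - 6 * (n:ℝ) ^ 2 * x) /
    ((n:ℝ) ^ 2 + x ^ 2) ^ 3) - auxG n 2 x)) ((n:ℝ) ^ 2) ?_ ?_ ?_ (fun x _ => hd1 x)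
    (fun x _ => hd2 x) hm ?_
  · exact continuous_iff_continuousAt.mpr fun x => (hd1 x).continuousAt
  · simp [aux_zero n hn]
  · simpa using (((aux_psi_inf _ hm).const_mul c).sub (aux_inf n)).const_mul s
  · intro x hx
    have h1 := hsc x _ hx (aux_D _ x hm hx)
    have h2 := aux_ode n x
    have h3 : ((n:ℝ) ^ 2 + x ^ 2) * (x / ((n:ℝ) ^ 2 + x ^ 2)) = x := by field_simp
    linear_combination h1 - s * h2 - 4 * s * c * h3

/-- Two-sided bounds for `φ_n`. -/
theorem stmt_4 (n : ℕ) (hn : 1 ≤ n) (x : ℝ) (hx : 0 < x) :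
    (4 * (n:ℝ)^2 / (4 * (n:ℝ)^2 + 1)) * (x / ((n:ℝ)^2 + x^2)) ≤ phi n x ∧
    phi n x ≤ (4 * (n:ℝ)^2 / (4 * (n:ℝ)^2 - 1)) * (x / ((n:ℝ)^2 + x^2)) := by
  have hn1 : (1:ℝ) ≤ (n:ℝ) ^ 2 := by
    have : (1:ℝ) ≤ n := by exact_mod_cast hn
    nlinarith
  rw [aux_phi]
  constructor
  · have := aux_cmp n hn (-1) (4 * (n:ℝ)^2 / (4 * (n:ℝ)^2 + 1)) ?_ x hx
    · linarith
    · intro y D hy hD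
      have h1 := (abs_le.mp hD).1
      have e : 4 * y * (4 * (n:ℝ)^2 / (4 * (n:ℝ)^2 + 1) - 1)
          = (4 * (n:ℝ)^2 / (4 * (n:ℝ)^2 + 1)) * (-(y / (n:ℝ)^2)) := by
        field_simp; ring
      rw [e]
      have : 0 ≤ (4 * (n:ℝ)^2 / (4 * (n:ℝ)^2 + 1)) := by positivity
      nlinarith [mul_le_mul_of_nonneg_left h1 this]
  · have := aux_cmp n hn 1 (4 * (n:ℝ)^2 / (4 * (n:ℝ)^2 - 1)) ?_ x hx
    · linarith
    · intro y D hy hD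
      have h1 := (abs_le.mp hD).2
      have hp : 0 < 4 * (n:ℝ)^2 - 1 := by linarith
      have e : 4 * y * (4 * (n:ℝ)^2 / (4 * (n:ℝ)^2 - 1) - 1)
          = (4 * (n:ℝ)^2 / (4 * (n:ℝ)^2 - 1)) * (y / (n:ℝ)^2) := by
        field_simp; ring
      rw [e]
      have : 0 ≤ (4 * (n:ℝ)^2 / (4 * (n:ℝ)^2 - 1)) := by positivity
      nlinarith [mul_le_mul_of_nonneg_left h1 this]
end

section
/- For every integer n ≥ 1 and every x > 0, (1/2) · (2n+1)x / ((n²+x²)((n+1)²+x²)) ≤ φ_n(x) - φ_{n+1}(x) ≤ 4 · (2n+1)x / ((n²+x²)((n+1)²+x²)). -/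
open Real

open Filter Topology MeasureTheory Set

/-- Twice differentiable, vanishing at `0` and at infinity. -/
structure Nice (w w1 w2 : ℝ → ℝ) : Prop where
  d1 : ∀ x, HasDerivAt w (w1 x) x
  d2 : ∀ x, HasDerivAt w1 (w2 x) x
  z : w 0 = 0
  lim : Tendsto w atTop (𝓝 0)

theorem Nice.comb {u u1 u2 v v1 v2 : ℝ → ℝ} (hu : Nice u u1 u2) (hv : Nice v v1 v2) (a b : ℝ) :
    Nice (fun x => a * u x + b * v x) (fun x => a * u1 x + b * v1 x)
      (fun x => a * u2 x + b * v2 x) where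
  d1 x := ((hu.d1 x).const_mul a).add ((hv.d1 x).const_mul b)
  d2 x := ((hu.d2 x).const_mul a).add ((hv.d2 x).const_mul b)
  z := by simp [hu.z, hv.z]
  lim := by simpa using (hu.lim.const_mul a).add (hv.lim.const_mul b)

/-- Maximum principle. -/
theorem Nice.nonneg {w w1 w2 : ℝ → ℝ} (hw : Nice w w1 w2) (N : ℝ) (hN : 0 < N)
    (h : ∀ x, 0 < x → 0 ≤ (N + x ^ 2) * w x - (x ^ 2 * w2 x + x * w1 x) / 4) :
    ∀ x, 0 < x → 0 ≤ w x := by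
  intro x0 hx0
  by_contra! hneg
  have hev : ∀ᶠ x in atTop, w x0 < w x := hw.lim.eventually (lt_mem_nhds hneg)
  obtain ⟨M, hM⟩ := eventually_atTop.1 hev
  have hxM : x0 < M := by
    by_contra! hc
    exact lt_irrefl _ (hM x0 hc)
  have hcont : Continuous w := continuous_iff_continuousAt.2 fun x => (hw.d1 x).continuousAt
  obtain ⟨x1, hx1, hmin⟩ := isCompact_Icc.exists_isMinOn (s := Icc 0 M)
    ⟨x0, hx0.le, hxM.le⟩ hcont.continuousOn
  have hle : w x1 ≤ w x0 := hmin ⟨hx0.le, hxM.le⟩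
  have h0 : 0 < x1 := by
    rcases hx1.1.lt_or_eq with h' | h'
    · exact h'
    · rw [← h', hw.z] at hle; linarith
  have h1 : x1 < M := by
    rcases hx1.2.lt_or_eq with h' | h'
    · exact h'
    · have := hM M le_rfl
      rw [← h'] at this; linarith
  have hloc : IsLocalMin w x1 := hmin.isLocalMin (Icc_mem_nhds h0 h1)
  have e1 : deriv w = w1 := funext fun x => (hw.d1 x).deriv
  have e2 : deriv w1 = w2 := funext fun x => (hw.d2 x).deriv
  have hz : w1 x1 = 0 := by rw [← e1]; exact hloc.deriv_eq_zero
  have h2 : 0 ≤ w2 x1 := by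
    by_contra! hc
    have hmax : IsLocalMax w x1 := isLocalMax_of_deriv_deriv_neg (by rwa [e1, e2])
      (by rw [e1, hz]) hcont.continuousAt
    have hconst : w =ᶠ[𝓝 x1] fun _ => w x1 := by
      filter_upwards [hloc, hmax] with y ha hb
      exact le_antisymm hb ha
    have hd := hconst.deriv.deriv_eq
    rw [e1, e2] at hd
    simp at hd
    linarith
  have := h x1 h0
  rw [hz] at this
  have p1 : (N + x1 ^ 2) * w x1 < 0 := mul_neg_of_pos_of_neg (by positivity) (by linarith)
  have p2 : 0 ≤ x1 ^ 2 * w2 x1 := by positivity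
  linarith

/-- Moments. -/
noncomputable def mom (n k : ℕ) (x : ℝ) : ℝ :=
  ∫ η in (0:ℝ)..π, Real.sin η ^ k * (Real.exp (-2 * x * Real.sin η) * Real.cos (2 * n * η))

theorem mom_deriv (n k : ℕ) (x : ℝ) : HasDerivAt (mom n k) (-2 * mom n (k + 1) x) x := by
  have := intervalIntegral.hasDerivAt_integral_of_dominated_loc_of_deriv_le (μ := volume)
    (a := 0) (b := π) (x₀ := x) (s := Metric.ball x 1)
    (F := fun x η => Real.sin η ^ k * (Real.exp (-2 * x * Real.sin η) * Real.cos (2 * n * η)))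
    (F' := fun x η => -2 * (Real.sin η ^ (k + 1) *
      (Real.exp (-2 * x * Real.sin η) * Real.cos (2 * n * η))))
    (bound := fun _ => 2 * Real.exp (2 * (|x| + 1)))
    (Metric.ball_mem_nhds x one_pos)
    (Eventually.of_forall fun y => by
      apply Continuous.aestronglyMeasurable; fun_prop)
    (by apply Continuous.intervalIntegrable; fun_prop)
    (by apply Continuous.aestronglyMeasurable; fun_prop)
    (by
      refine Eventually.of_forall fun η _ y hy => ?_
      have hy' : |y| ≤ |x| + 1 := by
        rw [Metric.mem_ball, Real.dist_eq] at hy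
        have := abs_sub_abs_le_abs_sub y x
        linarith
      have hs := Real.abs_sin_le_one η
      rw [Real.norm_eq_abs, abs_mul, abs_mul, abs_mul, abs_pow, Real.abs_exp]
      have a1 : |Real.sin η| ^ (k + 1) ≤ 1 := pow_le_one₀ (abs_nonneg _) hs
      have a2 : Real.exp (-2 * y * Real.sin η) ≤ Real.exp (2 * (|x| + 1)) := by
        apply Real.exp_le_exp.2
        have : |-2 * y * Real.sin η| ≤ 2 * (|x| + 1) := by
          rw [abs_mul, abs_mul]
          norm_num
          nlinarith [abs_nonneg y, abs_nonneg (Real.sin η)]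
        exact (le_abs_self _).trans this
      have a3 := Real.abs_cos_le_one (2 * n * η)
      have a4 : Real.exp (-2 * y * Real.sin η) * |Real.cos (2 * n * η)|
          ≤ Real.exp (2 * (|x| + 1)) * 1 := by gcongr
      have a5 : |Real.sin η| ^ (k + 1) * (Real.exp (-2 * y * Real.sin η) * |Real.cos (2 * n * η)|)
          ≤ 1 * (Real.exp (2 * (|x| + 1)) * 1) := by gcongr
      rw [show |(-2:ℝ)| = 2 by norm_num]
      linarith)
    (by simp)
    (by
      refine Eventually.of_forall fun η _ y hy => ?_
      have h1 : HasDerivAt (fun y : ℝ => -2 * y * Real.sin η) (-2 * Real.sin η) y := by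
        simpa using ((hasDerivAt_id y).const_mul (-2)).mul_const (Real.sin η)
      have h2 := ((h1.exp.mul_const (Real.cos (2 * n * η))).const_mul (Real.sin η ^ k))
      exact h2.congr_deriv (by ring))
  have h2 := this.2
  rw [intervalIntegral.integral_const_mul] at h2
  exact h2

theorem phi_eq (n : ℕ) : phi n = mom n 0 := by
  funext x; simp [phi, mom]

theorem phi_lim (n : ℕ) : Tendsto (phi n) atTop (𝓝 0) := by
  have := intervalIntegral.tendsto_integral_filter_of_dominated_convergence (μ := volume)
    (a := 0) (b := π) (l := atTop)
    (F := fun (x:ℝ) η => Real.exp (-2 * x * Real.sin η) * Real.cos (2 * n * η))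
    (f := fun _ => 0) (fun _ => 1)
    (Eventually.of_forall fun y => by
      apply Continuous.aestronglyMeasurable; fun_prop)
    (by
      filter_upwards [eventually_ge_atTop 0] with x hx
      refine Eventually.of_forall fun η hη => ?_
      rw [uIoc_of_le Real.pi_pos.le] at hη
      have hs : 0 ≤ Real.sin η := Real.sin_nonneg_of_nonneg_of_le_pi hη.1.le hη.2
      rw [Real.norm_eq_abs, abs_mul, Real.abs_exp]
      have a2 : Real.exp (-2 * x * Real.sin η) ≤ 1 := by
        apply Real.exp_le_one_iff.2
        have := mul_nonneg hx hs
        linarith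
      have a3 := Real.abs_cos_le_one (2 * n * η)
      exact mul_le_one₀ a2 (abs_nonneg _) a3)
    (by simp)
    (by
      have hne : ∀ᵐ η : ℝ, η ≠ π := by
        simp [ae_iff]
      filter_upwards [hne] with η hne hη
      rw [uIoc_of_le Real.pi_pos.le] at hη
      have hs : 0 < Real.sin η := Real.sin_pos_of_pos_of_lt_pi hη.1 (lt_of_le_of_ne hη.2 hne)
      have t1 : Tendsto (fun x : ℝ => -2 * x * Real.sin η) atTop atBot := by
        have : Tendsto (fun x : ℝ => (-2 * Real.sin η) * x) atTop atBot :=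
          tendsto_id.const_mul_atTop_of_neg (by linarith)
        refine this.congr fun x => by ring
      simpa using (Real.tendsto_exp_atBot.comp t1).mul_const (Real.cos (2 * n * η)))
  rw [intervalIntegral.integral_zero] at this
  exact this

theorem phi_zero (n : ℕ) (hn : 1 ≤ n) : phi n 0 = 0 := by
  have hn' : (2 * (n:ℝ)) ≠ 0 := by positivity
  simp only [phi, mul_zero, zero_mul, Real.exp_zero, one_mul]
  rw [intervalIntegral.integral_comp_mul_left (fun y => Real.cos y) hn']
  have : Real.sin (2 * n * π) = 0 := by
    have := Real.sin_nat_mul_pi (2 * n)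
    push_cast at this
    exact this
  simp [this]

theorem phi_nice (n : ℕ) (hn : 1 ≤ n) :
    Nice (phi n) (fun x => -2 * mom n 1 x) (fun x => 4 * mom n 2 x) where
  d1 x := by rw [phi_eq]; exact mom_deriv n 0 x
  d2 x := by
    exact ((mom_deriv n 1 x).const_mul (-2)).congr_deriv (by ring)
  z := phi_zero n hn
  lim := phi_lim n

theorem phi_ode (n : ℕ) (x : ℝ) :
    ((n:ℝ) ^ 2 + x ^ 2) * phi n x - (x ^ 2 * (4 * mom n 2 x) + x * (-2 * mom n 1 x)) / 4 = x := by
  have key : ∫ η in (0:ℝ)..π,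
      (2 * x * (Real.sin η ^ 1 * (Real.exp (-2 * x * Real.sin η) * Real.cos (2 * n * η)))
      + (4 * x ^ 2 + 4 * n ^ 2) *
        (Real.sin η ^ 0 * (Real.exp (-2 * x * Real.sin η) * Real.cos (2 * n * η)))
      + (-4 * x ^ 2) *
        (Real.sin η ^ 2 * (Real.exp (-2 * x * Real.sin η) * Real.cos (2 * n * η)))) = 4 * x := by
    rw [intervalIntegral.integral_eq_sub_of_hasDerivAt
      (f := fun η => (-2 * x * Real.cos η) * Real.exp (-2 * x * Real.sin η) * Real.cos (2 * n * η)
        + 2 * n * Real.exp (-2 * x * Real.sin η) * Real.sin (2 * n * η))]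
    · have s0 : Real.sin (2 * n * π) = 0 := by
        have := Real.sin_nat_mul_pi (2 * n)
        push_cast at this
        exact this
      have c0 : Real.cos (2 * n * π) = 1 := by
        have := Real.cos_nat_mul_two_pi n
        rw [← this]; congr 1; ring
      simp [s0, c0]
      ring
    · intro η _
      have h1 : HasDerivAt (fun η : ℝ => -2 * x * Real.sin η) (-2 * x * Real.cos η) η :=
        (Real.hasDerivAt_sin η).const_mul _
      have h2 : HasDerivAt (fun η : ℝ => -2 * x * Real.cos η) (-2 * x * -Real.sin η) η :=
        (Real.hasDerivAt_cos η).const_mul _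
      have h3 : HasDerivAt (fun η : ℝ => 2 * (n:ℝ) * η) (2 * (n:ℝ)) η := by
        simpa using (hasDerivAt_id η).const_mul (2 * (n:ℝ))
      have h4 := ((h2.mul h1.exp).mul h3.cos).add ((h1.exp.const_mul (2 * (n:ℝ))).mul h3.sin)
      refine h4.congr_deriv ?_
      simp only [Pi.mul_apply]
      have := Real.sin_sq_add_cos_sq η
      have hc : Real.sin η ^ 2 = 1 - Real.cos η ^ 2 := by linarith
      rw [hc]
      ring
    · apply Continuous.intervalIntegrable; fun_prop
  rw [intervalIntegral.integral_add, intervalIntegral.integral_add,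
    intervalIntegral.integral_const_mul, intervalIntegral.integral_const_mul,
    intervalIntegral.integral_const_mul] at key
  · change 2 * x * mom n 1 x + (4 * x ^ 2 + 4 * n ^ 2) * mom n 0 x + (-4 * x ^ 2) * mom n 2 x
      = 4 * x at key
    rw [phi_eq]
    linarith
  all_goals apply Continuous.intervalIntegrable; fun_prop

theorem f_nice (m : ℝ) (hm : 1 ≤ m) :
    Nice (fun x => x / (m ^ 2 + x ^ 2))
      (fun x => 1 / (m ^ 2 + x ^ 2) - 2 * x ^ 2 / (m ^ 2 + x ^ 2) ^ 2)
      (fun x => -6 * x / (m ^ 2 + x ^ 2) ^ 2 + 8 * x ^ 3 / (m ^ 2 + x ^ 2) ^ 3) where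
  d1 x := by
    have hP : m ^ 2 + x ^ 2 ≠ 0 := by positivity
    have h1 : HasDerivAt (fun x : ℝ => m ^ 2 + x ^ 2) (2 * x) x := by
      simpa using (hasDerivAt_pow 2 x).const_add (m ^ 2)
    refine ((hasDerivAt_id x).div h1 hP).congr_deriv ?_
    simp only [id]
    field_simp
    try ring
  d2 x := by
    have hP : m ^ 2 + x ^ 2 ≠ 0 := by positivity
    have h1 : HasDerivAt (fun x : ℝ => m ^ 2 + x ^ 2) (2 * x) x := by
      simpa using (hasDerivAt_pow 2 x).const_add (m ^ 2)
    refine (((hasDerivAt_const x (1:ℝ)).div h1 hP).sub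
      (((hasDerivAt_pow 2 x).const_mul 2).div (h1.pow 2) (pow_ne_zero 2 hP))).congr_deriv ?_
    simp only [Pi.pow_apply]
    field_simp
    try ring
  z := by simp
  lim := by
    refine squeeze_zero' (g := fun x : ℝ => x⁻¹) ?_ ?_ tendsto_inv_atTop_zero
    · filter_upwards [eventually_gt_atTop 0] with x hx
      positivity
    · filter_upwards [eventually_gt_atTop 0] with x hx
      rw [inv_eq_one_div, div_le_div_iff₀ (by positivity) hx]
      nlinarith [sq_nonneg m]

theorem g_nice (m k : ℝ) (hm : 1 ≤ m) (hk : 1 ≤ k) :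
    Nice (fun x => x / ((m ^ 2 + x ^ 2) * (k ^ 2 + x ^ 2)))
      (fun x => 1 / ((m ^ 2 + x ^ 2) * (k ^ 2 + x ^ 2))
        - 2 * x ^ 2 / ((m ^ 2 + x ^ 2) ^ 2 * (k ^ 2 + x ^ 2))
        - 2 * x ^ 2 / ((m ^ 2 + x ^ 2) * (k ^ 2 + x ^ 2) ^ 2))
      (fun x => -6 * x / ((m ^ 2 + x ^ 2) ^ 2 * (k ^ 2 + x ^ 2))
        -6 * x / ((m ^ 2 + x ^ 2) * (k ^ 2 + x ^ 2) ^ 2)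
        + 8 * x ^ 3 / ((m ^ 2 + x ^ 2) ^ 3 * (k ^ 2 + x ^ 2))
        + 8 * x ^ 3 / ((m ^ 2 + x ^ 2) ^ 2 * (k ^ 2 + x ^ 2) ^ 2)
        + 8 * x ^ 3 / ((m ^ 2 + x ^ 2) * (k ^ 2 + x ^ 2) ^ 3)) where
  d1 x := by
    have hP : m ^ 2 + x ^ 2 ≠ 0 := by positivity
    have hQ : k ^ 2 + x ^ 2 ≠ 0 := by positivity
    have h1 : HasDerivAt (fun x : ℝ => m ^ 2 + x ^ 2) (2 * x) x := by
      simpa using (hasDerivAt_pow 2 x).const_add (m ^ 2)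
    have h2 : HasDerivAt (fun x : ℝ => k ^ 2 + x ^ 2) (2 * x) x := by
      simpa using (hasDerivAt_pow 2 x).const_add (k ^ 2)
    refine ((hasDerivAt_id x).div (h1.mul h2) (mul_ne_zero hP hQ)).congr_deriv ?_
    simp only [id, Pi.mul_apply]
    field_simp
    try ring
  d2 x := by
    have hP : m ^ 2 + x ^ 2 ≠ 0 := by positivity
    have hQ : k ^ 2 + x ^ 2 ≠ 0 := by positivity
    have h1 : HasDerivAt (fun x : ℝ => m ^ 2 + x ^ 2) (2 * x) x := by
      simpa using (hasDerivAt_pow 2 x).const_add (m ^ 2)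
    have h2 : HasDerivAt (fun x : ℝ => k ^ 2 + x ^ 2) (2 * x) x := by
      simpa using (hasDerivAt_pow 2 x).const_add (k ^ 2)
    refine ((((hasDerivAt_const x (1:ℝ)).div (h1.mul h2) (mul_ne_zero hP hQ)).sub
      (((hasDerivAt_pow 2 x).const_mul 2).div ((h1.pow 2).mul h2)
        (mul_ne_zero (pow_ne_zero 2 hP) hQ))).sub
      (((hasDerivAt_pow 2 x).const_mul 2).div (h1.mul (h2.pow 2))
        (mul_ne_zero hP (pow_ne_zero 2 hQ)))).congr_deriv ?_
    simp only [Pi.pow_apply, Pi.mul_apply]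
    field_simp
    try ring
  z := by simp
  lim := by
    refine squeeze_zero' (g := fun x : ℝ => x / (m ^ 2 + x ^ 2)) ?_ ?_ (f_nice m hm).lim
    · filter_upwards [eventually_gt_atTop 0] with x hx
      positivity
    · filter_upwards [eventually_gt_atTop 0] with x hx
      apply div_le_div_of_nonneg_left hx.le (by positivity)
      apply le_mul_of_one_le_right (by positivity)
      nlinarith [sq_nonneg x]

theorem f_op (m : ℝ) (hm : 1 ≤ m) (x : ℝ) (hx : 0 < x) :
    ∃ e, |e| ≤ x / 4 ∧ (m ^ 2 + x ^ 2) * (x / (m ^ 2 + x ^ 2)) -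
      (x ^ 2 * (-6 * x / (m ^ 2 + x ^ 2) ^ 2 + 8 * x ^ 3 / (m ^ 2 + x ^ 2) ^ 3) +
        x * (1 / (m ^ 2 + x ^ 2) - 2 * x ^ 2 / (m ^ 2 + x ^ 2) ^ 2)) / 4 = x + e := by
  have hP : 1 ≤ m ^ 2 + x ^ 2 := by nlinarith [sq_nonneg x]
  set P := m ^ 2 + x ^ 2 with hPdef
  have hP0 : 0 < P := by linarith
  have ha1 : x ^ 2 / P ≤ 1 := by
    rw [div_le_one hP0]; nlinarith [sq_nonneg m]
  have ha0 : 0 ≤ x ^ 2 / P := by positivity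
  have hf0 : 0 ≤ x / P := by positivity
  have hf1 : x / P ≤ x := div_le_self hx.le hP
  refine ⟨-(x / P) * (1 - 8 * (x ^ 2 / P) + 8 * (x ^ 2 / P) ^ 2) / 4, ?_, ?_⟩
  · have hr : |1 - 8 * (x ^ 2 / P) + 8 * (x ^ 2 / P) ^ 2| ≤ 1 := by
      rw [abs_le]
      constructor
      · nlinarith [sq_nonneg (2 * (x ^ 2 / P) - 1)]
      · nlinarith
    rw [abs_div, abs_mul, abs_neg, abs_of_nonneg hf0]
    have : x / P * |1 - 8 * (x ^ 2 / P) + 8 * (x ^ 2 / P) ^ 2| ≤ x * 1 := by gcongr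
    norm_num
    linarith
  · field_simp
    ring

theorem phi_upper (m : ℕ) (hm : 1 ≤ m) (x : ℝ) (hx : 0 < x) :
    phi m x ≤ 4 / 3 * (x / ((m:ℝ) ^ 2 + x ^ 2)) := by
  have hm' : (1:ℝ) ≤ m := by exact_mod_cast hm
  have := ((f_nice m hm').comb (phi_nice m hm) (4 / 3) (-1)).nonneg ((m:ℝ) ^ 2) (by positivity)
    (by
      intro y hy
      obtain ⟨e, he, h1⟩ := f_op m hm' y hy
      have h2 := phi_ode m y
      have := abs_le.1 he
      linarith) x hx
  linarith

theorem phi_lower (m : ℕ) (hm : 1 ≤ m) (x : ℝ) (hx : 0 < x) :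
    4 / 5 * (x / ((m:ℝ) ^ 2 + x ^ 2)) ≤ phi m x := by
  have hm' : (1:ℝ) ≤ m := by exact_mod_cast hm
  have := ((f_nice m hm').comb (phi_nice m hm) (-4 / 5) 1).nonneg ((m:ℝ) ^ 2) (by positivity)
    (by
      intro y hy
      obtain ⟨e, he, h1⟩ := f_op m hm' y hy
      have h2 := phi_ode m y
      have := abs_le.1 he
      linarith) x hx
  linarith

theorem g_op (m k : ℝ) (hm : 1 ≤ m) (hk : 1 ≤ k) (x : ℝ) (hx : 0 < x) :
    ∃ q, -1 / 2 ≤ q ∧ q ≤ 2 / 3 ∧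
      (m ^ 2 + x ^ 2) * (x / ((m ^ 2 + x ^ 2) * (k ^ 2 + x ^ 2))) -
      (x ^ 2 * (-6 * x / ((m ^ 2 + x ^ 2) ^ 2 * (k ^ 2 + x ^ 2))
        -6 * x / ((m ^ 2 + x ^ 2) * (k ^ 2 + x ^ 2) ^ 2)
        + 8 * x ^ 3 / ((m ^ 2 + x ^ 2) ^ 3 * (k ^ 2 + x ^ 2))
        + 8 * x ^ 3 / ((m ^ 2 + x ^ 2) ^ 2 * (k ^ 2 + x ^ 2) ^ 2)
        + 8 * x ^ 3 / ((m ^ 2 + x ^ 2) * (k ^ 2 + x ^ 2) ^ 3)) +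
        x * (1 / ((m ^ 2 + x ^ 2) * (k ^ 2 + x ^ 2))
        - 2 * x ^ 2 / ((m ^ 2 + x ^ 2) ^ 2 * (k ^ 2 + x ^ 2))
        - 2 * x ^ 2 / ((m ^ 2 + x ^ 2) * (k ^ 2 + x ^ 2) ^ 2))) / 4
      = x / (k ^ 2 + x ^ 2) * (1 - q) := by
  have hP : 1 + x ^ 2 ≤ m ^ 2 + x ^ 2 := by nlinarith
  have hQ : 1 + x ^ 2 ≤ k ^ 2 + x ^ 2 := by nlinarith
  set P := m ^ 2 + x ^ 2 with hPdef
  set Q := k ^ 2 + x ^ 2 with hQdef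
  have hx2 : 0 < x ^ 2 := by positivity
  have hP0 : 0 < P := by linarith
  have hQ0 : 0 < Q := by linarith
  refine ⟨1 / P * (1 - 8 * (x ^ 2 / P) - 8 * (x ^ 2 / Q) + 8 * (x ^ 2 / P) ^ 2
    + 8 * (x ^ 2 / Q) ^ 2 + 8 * (x ^ 2 / P) * (x ^ 2 / Q)) / 4, ?_, ?_, ?_⟩
  · have i0 : 0 ≤ 1 / P := by positivity
    have i1 : 1 / P ≤ 1 := by rw [div_le_one hP0]; linarith
    generalize x ^ 2 / P = a
    generalize x ^ 2 / Q = b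
    have : -2 ≤ 1 - 8 * a - 8 * b + 8 * a ^ 2 + 8 * b ^ 2 + 8 * a * b := by
      nlinarith [sq_nonneg (1 - 2 * a - 2 * b), sq_nonneg (2 * a - 1), sq_nonneg (2 * b - 1)]
    nlinarith
  · have i0 : 0 ≤ 1 / P := by positivity
    have i1 : 1 / P ≤ 1 - x ^ 2 / P := by
      rw [le_sub_iff_add_le, ← add_div, div_le_one hP0]; linarith
    have ha0 : 0 ≤ x ^ 2 / P := by positivity
    have hb0 : 0 ≤ x ^ 2 / Q := by positivity
    have hb1 : x ^ 2 / Q ≤ 1 := by rw [div_le_one hQ0]; linarith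
    generalize x ^ 2 / P = a at *
    generalize x ^ 2 / Q = b at *
    generalize 1 / P = c at *
    have h1 : 1 - 8 * a - 8 * b + 8 * a ^ 2 + 8 * b ^ 2 + 8 * a * b ≤ 1 + 8 * a ^ 2 := by
      nlinarith [mul_nonneg hb0 (sub_nonneg.2 hb1), mul_nonneg ha0 (sub_nonneg.2 hb1)]
    have h2 : c * (1 - 8 * a - 8 * b + 8 * a ^ 2 + 8 * b ^ 2 + 8 * a * b)
        ≤ (1 - a) * (1 + 8 * a ^ 2) := by
      calc _ ≤ c * (1 + 8 * a ^ 2) := by gcongr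
        _ ≤ _ := by gcongr
    have h3 : (1 - a) * (1 + 8 * a ^ 2) ≤ 8 / 3 := by
      nlinarith [mul_nonneg ha0 (sq_nonneg (a - 2 / 3)), sq_nonneg (a - 2 / 3)]
    linarith
  · field_simp
    ring

/-- Two-sided bounds for the difference `φ_n - φ_{n+1}`. -/
theorem stmt_5 (n : ℕ) (hn : 1 ≤ n) (x : ℝ) (hx : 0 < x) :
    (1/2) * ((2 * (n:ℝ) + 1) * x / (((n:ℝ)^2 + x^2) * (((n:ℝ) + 1)^2 + x^2)))
      ≤ phi n x - phi (n + 1) x ∧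
    phi n x - phi (n + 1) x
      ≤ 4 * ((2 * (n:ℝ) + 1) * x / (((n:ℝ)^2 + x^2) * (((n:ℝ) + 1)^2 + x^2))) := by
  have hn' : (1:ℝ) ≤ n := by exact_mod_cast hn
  have hk' : (1:ℝ) ≤ (n:ℝ) + 1 := by linarith
  have hd := (phi_nice n hn).comb (phi_nice (n + 1) (by omega)) 1 (-1)
  have hg := g_nice n (n + 1) hn' hk'
  rw [mul_div_assoc]
  constructor
  · have := (hd.comb hg 1 (-(1 / 2) * (2 * n + 1))).nonneg ((n:ℝ) ^ 2) (by positivity)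
      (by
        intro y hy
        obtain ⟨q, hq0, hq1, h1⟩ := g_op n (n + 1) hn' hk' y hy
        have h2 := phi_ode n y
        have h3 := phi_ode (n + 1) y
        have h4 := phi_lower (n + 1) (by omega) y hy
        push_cast at h3 h4
        have hf : 0 < y / (((n:ℝ) + 1) ^ 2 + y ^ 2) := by positivity
        have h5 : 0 ≤ (2 * (n:ℝ) + 1) * (phi (n + 1) y
            - 1 / 2 * (y / (((n:ℝ) + 1) ^ 2 + y ^ 2) * (1 - q))) := by
          apply mul_nonneg (by positivity)
          nlinarith
        rw [← h1] at h5
        linarith) x hx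
    linarith
  · have := (hd.comb hg (-1) (4 * (2 * n + 1))).nonneg ((n:ℝ) ^ 2) (by positivity)
      (by
        intro y hy
        obtain ⟨q, hq0, hq1, h1⟩ := g_op n (n + 1) hn' hk' y hy
        have h2 := phi_ode n y
        have h3 := phi_ode (n + 1) y
        have h4 := phi_upper (n + 1) (by omega) y hy
        push_cast at h3 h4
        have hf : 0 < y / (((n:ℝ) + 1) ^ 2 + y ^ 2) := by positivity
        have h5 : 0 ≤ (2 * (n:ℝ) + 1) * (4 * (y / (((n:ℝ) + 1) ^ 2 + y ^ 2) * (1 - q))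
            - phi (n + 1) y) := by
          apply mul_nonneg (by positivity)
          nlinarith
        rw [← h1] at h5
        linarith) x hx
    linarith
end

section
/- For every β > -1 and every γ ∈ ℝ, ∫₀^π (sin η)^β e^{iγη} dη = π e^{iγπ/2} Γ(β+1) / (2^β Γ(1 + (β+γ)/2) Γ(1 + (β-γ)/2)). -/
open Real

/-- The integral on the left-hand side. -/
noncomputable def sinI (β γ : ℝ) : ℂ :=
  ∫ η in (0:ℝ)..π, ((Real.sin η ^ β : ℝ) : ℂ) * Complex.exp (Complex.I * γ * η)

/-- The right-hand side. -/
noncomputable def sinR (β γ : ℝ) : ℂ :=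
  (π : ℂ) * Complex.exp (Complex.I * γ * π / 2) * Complex.Gamma ((β : ℂ) + 1)
        / ((((2:ℝ) ^ β : ℝ) : ℂ) * Complex.Gamma (1 + ((β : ℂ) + γ) / 2)
            * Complex.Gamma (1 + ((β : ℂ) - γ) / 2))

/-- The real integral. -/
noncomputable def sinS (β : ℝ) : ℝ := ∫ η in (0:ℝ)..π, Real.sin η ^ β

lemma sin_rpow_cont {p : ℝ} (hp : 0 ≤ p) : Continuous fun x : ℝ => Real.sin x ^ p :=
  Real.continuous_sin.rpow_const fun _ => Or.inr hp

lemma sin_rpow_deriv (p : ℝ) {x : ℝ} (hx : x ∈ Set.Ioo 0 π) :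
    HasDerivAt (fun y : ℝ => Real.sin y ^ (p + 1)) ((p + 1) * Real.sin x ^ p * Real.cos x) x := by
  have := (Real.hasDerivAt_sin x).rpow_const (p := p + 1)
    (Or.inl (Real.sin_pos_of_mem_Ioo hx).ne')
  convert this using 1
  rw [add_sub_cancel_right]; ring

lemma sin_integrable {β : ℝ} (hβ : -1 < β) :
    IntervalIntegrable (fun x : ℝ => Real.sin x ^ β) MeasureTheory.volume 0 π := by
  have h0 : Continuous fun x : ℝ => Real.sin x ^ (β + 2) := sin_rpow_cont (by linarith)
  have key : IntervalIntegrable (fun x : ℝ => (β + 1) * Real.sin x ^ β)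
      MeasureTheory.volume 0 π := by
    apply intervalIntegral.intervalIntegrable_deriv_of_nonneg
      (g := fun x => Real.sin x ^ (β + 1) * Real.cos x
        + (β + 2) * ∫ t in (0:ℝ)..x, Real.sin t ^ (β + 2))
    · apply Continuous.continuousOn
      have h1 : Continuous fun x : ℝ => Real.sin x ^ (β + 1) := sin_rpow_cont (by linarith)
      have h2 : Continuous fun x : ℝ => ∫ t in (0:ℝ)..x, Real.sin t ^ (β + 2) :=
        intervalIntegral.continuous_primitive (fun a b => h0.intervalIntegrable a b) 0
      fun_prop
    · intro x hx
      rw [min_eq_left pi_pos.le, max_eq_right pi_pos.le] at hx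
      have hs := Real.sin_pos_of_mem_Ioo hx
      have h1 := (sin_rpow_deriv β hx).mul (Real.hasDerivAt_cos x)
      have h2 := (h0.integral_hasStrictDerivAt 0 x).hasDerivAt.const_mul (β + 2)
      refine (h1.add h2).congr_deriv (Eq.symm ?_)
      rw [Real.rpow_add hs, Real.rpow_add hs, Real.rpow_one, Real.rpow_two]
      linear_combination (-(β+1) * Real.sin x ^ β) * Real.sin_sq_add_cos_sq x
    · intro x hx
      rw [min_eq_left pi_pos.le, max_eq_right pi_pos.le] at hx
      have hs := Real.sin_pos_of_mem_Ioo hx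
      have := Real.rpow_pos_of_pos hs β
      have : 0 < β + 1 := by linarith
      positivity
  have := key.const_mul (β + 1)⁻¹
  refine this.congr (fun x _ => ?_)
  have : β + 1 ≠ 0 := by linarith
  field_simp

lemma sinI_integrable {β : ℝ} (γ : ℝ) (hβ : -1 < β) :
    IntervalIntegrable (fun η : ℝ => ((Real.sin η ^ β : ℝ) : ℂ) * Complex.exp (Complex.I * γ * η))
      MeasureTheory.volume 0 π := by
  apply IntervalIntegrable.mul_continuousOn
  · exact ⟨(sin_integrable hβ).1.ofReal, (sin_integrable hβ).2.ofReal⟩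
  · fun_prop

lemma sinI_rec {β : ℝ} (γ : ℝ) (hβ : -1 < β) :
    ((β : ℂ) + 1) * sinI β γ = ((β : ℂ) + 2 - γ ^ 2 / (β + 2)) * sinI (β + 2) γ := by
  have hb2 : (β : ℂ) + 2 ≠ 0 := by
    have : β + 2 ≠ 0 := by linarith
    exact_mod_cast this
  have i1 := (sinI_integrable γ hβ).const_mul ((β : ℂ) + 1)
  have i2 := (sinI_integrable (β := β + 2) γ (by linarith)).const_mul
    ((β : ℂ) + 2 - γ ^ 2 / (β + 2))
  have key := intervalIntegral.integral_eq_sub_of_hasDerivAt_of_le pi_pos.le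
    (f := fun x : ℝ => (((Real.sin x ^ (β + 1) : ℝ) : ℂ) * ((Real.cos x : ℝ) : ℂ)
      - Complex.I * γ / (β + 2) * ((Real.sin x ^ (β + 1 + 1) : ℝ) : ℂ))
        * Complex.exp (Complex.I * γ * x)) ?_ ?_ (i1.sub i2)
  · rw [intervalIntegral.integral_sub i1 i2, intervalIntegral.integral_const_mul,
      intervalIntegral.integral_const_mul] at key
    have e1 : (0:ℝ) ^ (β + 1) = 0 := Real.zero_rpow (by linarith)
    have e2 : (0:ℝ) ^ (β + 1 + 1) = 0 := Real.zero_rpow (by linarith)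
    simp only [Real.sin_pi, Real.sin_zero, e1, e2] at key
    simp only [Complex.ofReal_zero, zero_mul, mul_zero, sub_zero] at key
    exact sub_eq_zero.mp key
  · apply Continuous.continuousOn
    have h1 : Continuous fun x : ℝ => Real.sin x ^ (β + 1) := sin_rpow_cont (by linarith)
    have h2 : Continuous fun x : ℝ => Real.sin x ^ (β + 1 + 1) := sin_rpow_cont (by linarith)
    fun_prop
  · intro x hx
    have hs := Real.sin_pos_of_mem_Ioo hx
    have h1 := (sin_rpow_deriv β hx).ofReal_comp
    have h2 := (sin_rpow_deriv (β + 1) hx).ofReal_comp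
    have h3 := (Real.hasDerivAt_cos x).ofReal_comp
    have h4 : HasDerivAt (fun x : ℝ => Complex.exp (Complex.I * γ * x))
        (Complex.exp (Complex.I * γ * x) * (Complex.I * γ)) x := by
      have := ((hasDerivAt_id (x : ℂ)).const_mul (Complex.I * γ)).cexp.comp_ofReal
      simpa using this
    have := ((h1.mul h3).sub (h2.const_mul (Complex.I * γ / (β + 2)))).mul h4
    refine this.congr_deriv (Eq.symm ?_)
    simp only [Pi.mul_apply, Pi.sub_apply]
    rw [Real.rpow_add hs β 2, Real.rpow_add hs (β + 1) 1, Real.rpow_add hs β 1, Real.rpow_one,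
      Real.rpow_two]
    have hsc : ((Real.sin x : ℝ) : ℂ) ^ 2 + ((Real.cos x : ℝ) : ℂ) ^ 2 = 1 := by
      exact_mod_cast Real.sin_sq_add_cos_sq x
    push_cast at hsc ⊢
    field_simp
    linear_combination (-(β+1) * (β + 2) * ((Real.sin x ^ β : ℝ) : ℂ) : ℂ) * hsc
      + ((γ:ℂ)^2 * (Complex.sin x)^2 * ((Real.sin x ^ β : ℝ) : ℂ)) * Complex.I_sq

lemma sinI_zero (β : ℝ) : sinI β 0 = (sinS β : ℂ) := by
  simp only [sinI, sinS]
  rw [← intervalIntegral.integral_ofReal]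
  simp

lemma sinS_rec {β : ℝ} (hβ : -1 < β) : (β + 1) * sinS β = (β + 2) * sinS (β + 2) := by
  have := sinI_rec 0 hβ
  rw [sinI_zero, sinI_zero] at this
  simp only [Complex.ofReal_zero, ne_eq, OfNat.ofNat_ne_zero, not_false_eq_true, zero_pow,
    zero_div, sub_zero] at this
  exact_mod_cast this

lemma sinS_pos {β : ℝ} (hβ : -1 < β) : 0 < sinS β :=
  intervalIntegral.intervalIntegral_pos_of_pos_on (sin_integrable hβ)
    (fun x hx => Real.rpow_pos_of_pos (Real.sin_pos_of_mem_Ioo hx) β) pi_pos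

lemma sinR_rec {β : ℝ} (γ : ℝ) (hβ : -1 < β) :
    ((β : ℂ) + 1) * sinR β γ = ((β : ℂ) + 2 - γ ^ 2 / (β + 2)) * sinR (β + 2) γ := by
  have hb2 : (β : ℂ) + 2 ≠ 0 := by
    have : β + 2 ≠ 0 := by linarith
    exact_mod_cast this
  have hb1 : (β : ℂ) + 1 ≠ 0 := by
    have : β + 1 ≠ 0 := by linarith
    exact_mod_cast this
  have hG : Complex.Gamma ((β + 2 : ℝ) + 1 : ℂ) = (β + 2) * ((β + 1) * Complex.Gamma (β + 1)) := by
    have e : (((β + 2 : ℝ) : ℂ) + 1) = (β : ℂ) + 2 + 1 := by push_cast; ring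
    have e' : ((β : ℂ) + 2) = (β : ℂ) + 1 + 1 := by ring
    rw [← Complex.Gamma_add_one _ hb1, ← e', ← Complex.Gamma_add_one _ hb2, e]
  have h1 := Complex.one_div_Gamma_eq_self_mul_one_div_Gamma_add_one (1 + ((β : ℂ) + γ) / 2)
  have h2 := Complex.one_div_Gamma_eq_self_mul_one_div_Gamma_add_one (1 + ((β : ℂ) - γ) / 2)
  have h3 : (2:ℝ) ^ (β + 2) = 2 ^ β * 4 := by
    rw [Real.rpow_add two_pos]; norm_num
  unfold sinR
  rw [hG, h3]
  have a1 : (1 + (((β + 2 : ℝ) : ℂ) + γ) / 2) = 1 + ((β : ℂ) + γ) / 2 + 1 := by push_cast; ring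
  have a2 : (1 + (((β + 2 : ℝ) : ℂ) - γ) / 2) = 1 + ((β : ℂ) - γ) / 2 + 1 := by push_cast; ring
  rw [a1, a2]
  simp only [div_eq_mul_inv, mul_inv] at *
  rw [h1, h2]
  have hp : (((2:ℝ) ^ β : ℝ) : ℂ) ≠ 0 := by
    exact_mod_cast (Real.rpow_pos_of_pos two_pos β).ne'
  generalize (Complex.Gamma (1 + ((β : ℂ) + γ) * 2⁻¹ + 1))⁻¹ = G1
  generalize (Complex.Gamma (1 + ((β : ℂ) - γ) * 2⁻¹ + 1))⁻¹ = G2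
  generalize Complex.Gamma ((β : ℂ) + 1) = G3
  push_cast [mul_inv] at hp ⊢
  field_simp
  ring

lemma sinS_eq {β : ℝ} (hβ : 1 ≤ β) : (sinS β : ℂ) = sinR β 0 := by
  have hs : 0 ≤ (β + 1) / 2 - 1 := by linarith
  have hcv := intervalIntegral.integral_comp_mul_deriv (a := 0) (b := π)
    (f := fun x => (1 - Real.cos x) / 2) (f' := fun x => Real.sin x / 2)
    (g := fun x => (x * (1 - x)) ^ ((β + 1) / 2 - 1))
    (fun x _ => by simpa using ((Real.hasDerivAt_cos x).const_sub 1).div_const 2)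
    (by fun_prop) ((by fun_prop : Continuous fun x : ℝ => x * (1 - x)).rpow_const
      fun _ => Or.inr hs)
  have hL : (∫ x in (0:ℝ)..π, ((fun x : ℝ => (x * (1 - x)) ^ ((β + 1) / 2 - 1)) ∘
      (fun x => (1 - Real.cos x) / 2)) x * (Real.sin x / 2)) = (2 ^ β)⁻¹ * sinS β := by
    unfold sinS
    rw [← intervalIntegral.integral_const_mul]
    apply intervalIntegral.integral_congr
    intro x hx
    rw [Set.uIcc_of_le pi_pos.le] at hx
    have h0 := Real.sin_nonneg_of_mem_Icc hx
    have e : (1 - Real.cos x) / 2 * (1 - (1 - Real.cos x) / 2) = (Real.sin x / 2) ^ (2:ℝ) := by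
      rw [Real.rpow_two]; linear_combination (-1/4) * Real.sin_sq_add_cos_sq x
    simp only [Function.comp]
    rw [e, ← Real.rpow_mul (by positivity)]
    rcases h0.eq_or_lt with h | h
    · rw [← h, Real.zero_rpow (by linarith)]; simp
    · rw [← Real.rpow_add_one (by positivity), Real.div_rpow h0 two_pos.le]
      have : 2 * ((β + 1) / 2 - 1) + 1 = β := by ring
      rw [this]; ring
  rw [hL] at hcv
  have hB : Complex.betaIntegral (((β : ℂ) + 1) / 2) (((β : ℂ) + 1) / 2)
      = ((∫ x in (0:ℝ)..1, (x * (1 - x)) ^ ((β + 1) / 2 - 1) : ℝ) : ℂ) := by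
    unfold Complex.betaIntegral
    rw [← intervalIntegral.integral_ofReal]
    apply intervalIntegral.integral_congr
    intro x hx
    rw [Set.uIcc_of_le zero_le_one] at hx
    have hx1 : 0 ≤ 1 - x := by linarith [hx.2]
    simp only
    rw [Real.mul_rpow hx.1 hx1, Complex.ofReal_mul, Complex.ofReal_cpow hx.1,
      Complex.ofReal_cpow hx1]
    push_cast; rfl
  have e1 : (1 - Real.cos 0) / 2 = 0 := by simp
  have e2 : (1 - Real.cos π) / 2 = 1 := by simp
  simp only [e1, e2] at hcv
  rw [← hcv] at hB
  have hre : 0 < (((β : ℂ) + 1) / 2).re := by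
    have : ((β : ℂ) + 1) / 2 = (((β + 1) / 2 : ℝ) : ℂ) := by push_cast; ring
    rw [this, Complex.ofReal_re]; linarith
  rw [Complex.betaIntegral_eq_Gamma_mul_div _ _ hre hre, add_halves] at hB
  have hd := Complex.Gamma_mul_Gamma_add_half (((β : ℂ) + 1) / 2)
  have e3 : ((β : ℂ) + 1) / 2 + 1 / 2 = 1 + β / 2 := by ring
  have e4 : 2 * (((β : ℂ) + 1) / 2) = β + 1 := by ring
  have e5 : (2 : ℂ) ^ (1 - ((β : ℂ) + 1)) = ((((2:ℝ) ^ β : ℝ) : ℂ))⁻¹ := by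
    have : (1 - ((β : ℂ) + 1)) = -β := by ring
    rw [this, Complex.cpow_neg, Complex.ofReal_cpow two_pos.le]; simp
  rw [e3, e4, e5] at hd
  have n1 : Complex.Gamma (1 + (β : ℂ) / 2) ≠ 0 := by
    apply Complex.Gamma_ne_zero_of_re_pos
    have : 1 + (β : ℂ) / 2 = ((1 + β / 2 : ℝ) : ℂ) := by push_cast; ring
    rw [this, Complex.ofReal_re]; linarith
  have n2 : Complex.Gamma ((β : ℂ) + 1) ≠ 0 := by
    apply Complex.Gamma_ne_zero_of_re_pos
    simp; linarith
  have n3 : (((2:ℝ) ^ β : ℝ) : ℂ) ≠ 0 := by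
    exact_mod_cast (Real.rpow_pos_of_pos two_pos β).ne'
  have hpi : ((√π : ℝ) : ℂ) ^ 2 = π := by
    exact_mod_cast Real.sq_sqrt pi_pos.le
  unfold sinR
  push_cast at hB n3 hd ⊢
  simp only [add_zero, sub_zero, mul_zero, zero_mul, zero_div, Complex.exp_zero, mul_one]
  rw [← hpi]
  generalize Complex.Gamma (1 + (β : ℂ) / 2) = A at *
  generalize Complex.Gamma ((β : ℂ) + 1) = B at *
  generalize Complex.Gamma (((β : ℂ) + 1) / 2) = C at *
  have hC : C = B * (((2 ^ β : ℝ) : ℂ))⁻¹ * ((√π : ℝ) : ℂ) / A := by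
    rw [← hd]; field_simp
  subst hC
  field_simp at hB ⊢
  linear_combination -hB

lemma sinI_bound {N : ℝ} (γ : ℝ) (hN : 0 ≤ N) :
    ‖sinI N γ / sinS N - Complex.exp (Complex.I * γ * π / 2)‖
      ≤ |γ| * ((1 + π ^ 2 / 4) / 2) * (√(N + 2))⁻¹ := by
  have hS := sinS_pos (β := N) (by linarith)
  have hSc : (sinS N : ℂ) ≠ 0 := by exact_mod_cast hS.ne'
  set d := √(N + 2) with hd
  have hdpos : 0 < d := Real.sqrt_pos.mpr (by linarith)
  have hd2 : d ^ 2 = N + 2 := Real.sq_sqrt (by linarith)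
  have iN := sin_integrable (β := N) (by linarith)
  have iN2 := sin_integrable (β := N + 2) (by linarith)
  have hdiff : sinI N γ - sinS N * Complex.exp (Complex.I * γ * π / 2)
      = ∫ η in (0:ℝ)..π, (((Real.sin η ^ N : ℝ) : ℂ) * Complex.exp (Complex.I * γ * η)
        - ((Real.sin η ^ N : ℝ) : ℂ) * Complex.exp (Complex.I * γ * π / 2)) := by
    rw [intervalIntegral.integral_sub (sinI_integrable γ (by linarith)),
      intervalIntegral.integral_mul_const, intervalIntegral.integral_ofReal]
    · rfl
    · exact IntervalIntegrable.mul_const ⟨iN.1.ofReal, iN.2.ofReal⟩ _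
  have hb : ‖sinI N γ - sinS N * Complex.exp (Complex.I * γ * π / 2)‖
      ≤ ∫ η in (0:ℝ)..π, (|γ| / 2 * (d⁻¹ + π ^ 2 / 4 * d) * Real.sin η ^ N
          - |γ| / 2 * (π ^ 2 / 4 * d) * Real.sin η ^ (N + 2)) := by
    rw [hdiff]
    apply intervalIntegral.norm_integral_le_of_norm_le pi_pos.le
    · have hne : ∀ᵐ t : ℝ, t ≠ π := by
        simp [MeasureTheory.ae_iff, MeasureTheory.measure_singleton]
      filter_upwards [hne] with t htne ht
      have ht' : t ∈ Set.Ioo 0 π := ⟨ht.1, lt_of_le_of_ne ht.2 htne⟩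
      have hs := Real.sin_pos_of_mem_Ioo ht'
      have hp := Real.rpow_pos_of_pos hs N
      rw [← mul_sub, norm_mul, Complex.norm_of_nonneg hp.le, Real.rpow_add hs, Real.rpow_two]
      have e : Complex.exp (Complex.I * γ * t) - Complex.exp (Complex.I * γ * π / 2)
          = Complex.exp ((γ * π / 2 : ℝ) * Complex.I)
            * (Complex.exp (Complex.I * (γ * (t - π / 2) : ℝ)) - 1) := by
        rw [mul_sub, ← Complex.exp_add, mul_one]
        congr 2 <;> (push_cast; ring)
      have h1 : ‖Complex.exp (Complex.I * γ * t) - Complex.exp (Complex.I * γ * π / 2)‖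
          ≤ |γ| * |t - π / 2| := by
        rw [e, norm_mul, Complex.norm_exp_ofReal_mul_I, one_mul, ← abs_mul]
        exact Real.norm_exp_I_mul_ofReal_sub_one_le
      have h2 : |t - π / 2| ≤ π / 2 * |Real.cos t| := by
        have := Real.mul_abs_le_abs_sin (x := t - π / 2)
          (by rw [abs_le]; constructor <;> linarith [ht.1, ht.2])
        rw [Real.sin_sub_pi_div_two, abs_neg] at this
        have h := mul_le_mul_of_nonneg_left this (by positivity : 0 ≤ π / 2)
        calc |t - π / 2| = π / 2 * (2 / π * |t - π / 2|) := by field_simp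
          _ ≤ _ := h
      have h3 : |t - π / 2| ≤ 1 / 2 * (d⁻¹ + π ^ 2 / 4 * d * (1 - Real.sin t ^ 2)) := by
        have hc : 1 - Real.sin t ^ 2 = |Real.cos t| ^ 2 := by
          rw [sq_abs]; linarith [Real.sin_sq_add_cos_sq t]
        rw [hc]
        have := mul_nonneg hdpos.le (sq_nonneg (d⁻¹ - π / 2 * |Real.cos t|))
        have e2 : d * (d⁻¹ - π / 2 * |Real.cos t|) ^ 2
          = d⁻¹ - 2 * (π / 2 * |Real.cos t|) + π ^ 2 / 4 * d * |Real.cos t| ^ 2 := by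
          field_simp; ring
        linarith
      calc _ ≤ Real.sin t ^ N * (|γ| *
              (1 / 2 * (d⁻¹ + π ^ 2 / 4 * d * (1 - Real.sin t ^ 2)))) := by
            gcongr
            exact h1.trans (by gcongr)
        _ = _ := by ring
    · exact (iN.const_mul _).sub (iN2.const_mul _)
  rw [intervalIntegral.integral_sub (iN.const_mul _) (iN2.const_mul _),
    intervalIntegral.integral_const_mul, intervalIntegral.integral_const_mul] at hb
  change _ ≤ _ * sinS N - _ * sinS (N + 2) at hb
  have hrec := sinS_rec (β := N) (by linarith)
  have hS2 : sinS (N + 2) = sinS N - sinS N / d ^ 2 := by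
    rw [hd2]
    have : N + 2 ≠ 0 := by linarith
    field_simp
    linarith
  rw [hS2] at hb
  have e3 : sinI N γ / sinS N - Complex.exp (Complex.I * γ * π / 2)
      = (sinI N γ - sinS N * Complex.exp (Complex.I * γ * π / 2)) / sinS N := by
    field_simp
  rw [e3, norm_div, Complex.norm_of_nonneg hS.le, div_le_iff₀ hS]
  refine hb.trans (le_of_eq ?_)
  field_simp
  ring

lemma gamma_q {s : ℂ} (hs : 0 < s.re) :
    Filter.Tendsto (fun n : ℕ => (n : ℂ) ^ s * (n.factorial : ℂ) / Complex.Gamma (s + n + 1))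
      Filter.atTop (nhds 1) := by
  have hG := Complex.Gamma_ne_zero_of_re_pos hs
  have h := (Complex.GammaSeq_tendsto_Gamma s).div_const (Complex.Gamma s)
  rw [div_self hG] at h
  refine h.congr fun n => ?_
  rw [Complex.GammaSeq_eq_betaIntegral_of_re_pos hs,
    Complex.betaIntegral_eq_Gamma_mul_div _ _ hs (by simp; positivity),
    Complex.Gamma_nat_eq_factorial, add_assoc]
  field_simp

lemma gamma_ne {s : ℝ} (hs : 0 < s) : Complex.Gamma (s : ℂ) ≠ 0 :=
  Complex.Gamma_ne_zero_of_re_pos (by simpa using hs)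

lemma sinR_lim {β γ : ℝ} (h1 : 0 < β + γ) (h2 : 0 < β - γ) (hβ : 1 ≤ β) :
    Filter.Tendsto (fun n : ℕ => sinR (β + 2 * n) γ / sinS (β + 2 * n))
      Filter.atTop (nhds (Complex.exp (Complex.I * γ * π / 2))) := by
  have q1 := gamma_q (s := (((β + γ) / 2 : ℝ) : ℂ)) (by rw [Complex.ofReal_re]; linarith)
  have q2 := gamma_q (s := (((β - γ) / 2 : ℝ) : ℂ)) (by rw [Complex.ofReal_re]; linarith)
  have q0 := gamma_q (s := ((β / 2 : ℝ) : ℂ)) (by rw [Complex.ofReal_re]; linarith)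
  have := ((q1.mul q2).div (q0.mul q0) (by simp)).const_mul
    (Complex.exp (Complex.I * γ * π / 2))
  simp only [mul_one, div_one] at this
  refine this.congr' ?_
  filter_upwards [Filter.eventually_gt_atTop 0] with n hn
  have hn0 : (n : ℂ) ≠ 0 := by exact_mod_cast hn.ne'
  have hnn : (0:ℝ) ≤ n := n.cast_nonneg
  simp only [Pi.div_apply]
  rw [sinS_eq (by linarith)]
  unfold sinR
  have a1 : (1 + (((β + 2 * n : ℝ) : ℂ) + γ) / 2) = (((β + γ) / 2 : ℝ) : ℂ) + n + 1 := by
    push_cast; ring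
  have a2 : (1 + (((β + 2 * n : ℝ) : ℂ) - γ) / 2) = (((β - γ) / 2 : ℝ) : ℂ) + n + 1 := by
    push_cast; ring
  have a3 : (1 + (((β + 2 * n : ℝ) : ℂ) + (0:ℝ)) / 2) = ((β / 2 : ℝ) : ℂ) + n + 1 := by
    push_cast; ring
  have a4 : (1 + (((β + 2 * n : ℝ) : ℂ) - (0:ℝ)) / 2) = ((β / 2 : ℝ) : ℂ) + n + 1 := by
    push_cast; ring
  have a5 : Complex.exp (Complex.I * (0:ℝ) * π / 2) = 1 := by simp
  rw [a1, a2, a3, a4, a5]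
  have n1 : Complex.Gamma ((((β + γ) / 2 : ℝ) : ℂ) + n + 1) ≠ 0 := by
    have := gamma_ne (s := (β + γ) / 2 + n + 1) (by linarith)
    push_cast at this ⊢; exact this
  have n2 : Complex.Gamma ((((β - γ) / 2 : ℝ) : ℂ) + n + 1) ≠ 0 := by
    have := gamma_ne (s := (β - γ) / 2 + n + 1) (by linarith)
    push_cast at this ⊢; exact this
  have n3 : Complex.Gamma (((β / 2 : ℝ) : ℂ) + n + 1) ≠ 0 := by
    have := gamma_ne (s := β / 2 + n + 1) (by linarith)
    push_cast at this ⊢; exact this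
  have n4 : Complex.Gamma (((β + 2 * n : ℝ) : ℂ) + 1) ≠ 0 := by
    have := gamma_ne (s := β + 2 * n + 1) (by linarith)
    push_cast at this ⊢; exact this
  have n5 : (((2:ℝ) ^ (β + 2 * n) : ℝ) : ℂ) ≠ 0 := by
    exact_mod_cast (Real.rpow_pos_of_pos two_pos _).ne'
  have n6 : (π : ℂ) ≠ 0 := by exact_mod_cast pi_pos.ne'
  have n7 : (n.factorial : ℂ) ≠ 0 := by exact_mod_cast n.factorial_ne_zero
  have hp : (n : ℂ) ^ (((β + γ) / 2 : ℝ) : ℂ) * (n : ℂ) ^ (((β - γ) / 2 : ℝ) : ℂ)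
      = (n : ℂ) ^ ((β / 2 : ℝ) : ℂ) * (n : ℂ) ^ ((β / 2 : ℝ) : ℂ) := by
    rw [← Complex.cpow_add _ _ hn0, ← Complex.cpow_add _ _ hn0]
    congr 1; push_cast; ring
  have n8 : (n : ℂ) ^ ((β / 2 : ℝ) : ℂ) ≠ 0 := by simp [Complex.cpow_eq_zero_iff, hn0]
  generalize Complex.Gamma ((((β + γ) / 2 : ℝ) : ℂ) + n + 1) = G1 at *
  generalize Complex.Gamma ((((β - γ) / 2 : ℝ) : ℂ) + n + 1) = G2 at *
  generalize Complex.Gamma (((β / 2 : ℝ) : ℂ) + n + 1) = G3 at *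
  generalize Complex.Gamma (((β + 2 * n : ℝ) : ℂ) + 1) = G4 at *
  generalize (((2:ℝ) ^ (β + 2 * n) : ℝ) : ℂ) = T at *
  generalize (n : ℂ) ^ ((β / 2 : ℝ) : ℂ) = P3 at *
  generalize (n : ℂ) ^ (((β + γ) / 2 : ℝ) : ℂ) = P1 at *
  generalize (n : ℂ) ^ (((β - γ) / 2 : ℝ) : ℂ) = P2 at *
  generalize Complex.exp (Complex.I * γ * π / 2) = E at *
  field_simp
  linear_combination E * hp

lemma sinI_lim {β : ℝ} (γ : ℝ) (hβ : 0 ≤ β) :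
    Filter.Tendsto (fun n : ℕ => sinI (β + 2 * n) γ / sinS (β + 2 * n))
      Filter.atTop (nhds (Complex.exp (Complex.I * γ * π / 2))) := by
  rw [tendsto_iff_norm_sub_tendsto_zero]
  have hN : Filter.Tendsto (fun n : ℕ => β + 2 * (n:ℝ) + 2) Filter.atTop Filter.atTop := by
    apply Filter.tendsto_atTop_add_const_right
    apply Filter.tendsto_atTop_add_const_left
    exact Filter.Tendsto.const_mul_atTop two_pos tendsto_natCast_atTop_atTop
  have hz := ((Real.tendsto_sqrt_atTop.comp hN).inv_tendsto_atTop).const_mul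
    (|γ| * ((1 + π ^ 2 / 4) / 2))
  rw [mul_zero] at hz
  refine squeeze_zero (fun _ => norm_nonneg _) (fun n => ?_) hz
  exact sinI_bound γ (by positivity)

lemma sin_coef_ne {β γ : ℝ} (h1 : 0 < β + γ) (h2 : 0 < β - γ) :
    ((β : ℂ) + 2 - γ ^ 2 / (β + 2)) ≠ 0 := by
  have hb : 0 < β + 2 := by linarith
  have : β + 2 - γ ^ 2 / (β + 2) ≠ 0 := by
    have e : β + 2 - γ ^ 2 / (β + 2) = (β + 2 + γ) * (β + 2 - γ) / (β + 2) := by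
      field_simp; ring
    rw [e]
    have : 0 < β + 2 + γ := by linarith
    have : 0 < β + 2 - γ := by linarith
    positivity
  exact_mod_cast this

lemma sin_large {β γ : ℝ} (h1 : 0 < β + γ) (h2 : 0 < β - γ) (hβ : 1 ≤ β) :
    sinI β γ = sinR β γ := by
  have hQ : ∀ n : ℕ, sinI (β + 2 * n) γ / sinR (β + 2 * n) γ = sinI β γ / sinR β γ := by
    intro n
    induction n with
    | zero => simp
    | succ k ih =>
      rw [← ih]
      have hk : (0:ℝ) ≤ k := k.cast_nonneg
      have e : β + 2 * ((k + 1 : ℕ) : ℝ) = β + 2 * k + 2 := by push_cast; ring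
      rw [e]
      have r1 := sinI_rec (β := β + 2 * k) γ (by linarith)
      have r2 := sinR_rec (β := β + 2 * k) γ (by linarith)
      have c1 := sin_coef_ne (β := β + 2 * k) (γ := γ) (by linarith) (by linarith)
      have c2 : (((β + 2 * k : ℝ) : ℂ) + 1) ≠ 0 := by
        have : β + 2 * k + 1 ≠ 0 := by linarith
        exact_mod_cast this
      rw [← mul_div_mul_left _ _ c1, ← r1, ← r2, mul_div_mul_left _ _ c2]
  have hE := Complex.exp_ne_zero (Complex.I * γ * π / 2)
  have hl := (sinI_lim γ (by linarith : 0 ≤ β)).div (sinR_lim h1 h2 hβ) hE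
  rw [div_self hE] at hl
  have hc : Filter.Tendsto (fun _ : ℕ => sinI β γ / sinR β γ) Filter.atTop (nhds 1) := by
    refine hl.congr fun n => ?_
    have hS : (sinS (β + 2 * n) : ℂ) ≠ 0 := by
      have hn : (0:ℝ) ≤ n := n.cast_nonneg
      exact_mod_cast (sinS_pos (β := β + 2 * n) (by linarith)).ne'
    rw [← hQ n]
    exact div_div_div_cancel_right₀ hS _ _
  have h := tendsto_nhds_unique hc tendsto_const_nhds
  have h' := eq_of_div_eq_one h.symm
  exact h'

lemma sin_all (n : ℕ) : ∀ β γ : ℝ, -1 < β → 1 + |γ| ≤ β + 2 * n → sinI β γ = sinR β γ := by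
  induction n with
  | zero =>
    intro β γ _ h
    simp only [Nat.cast_zero, mul_zero, add_zero] at h
    have := abs_nonneg γ
    exact sin_large (by linarith [neg_abs_le γ]) (by linarith [le_abs_self γ]) (by linarith)
  | succ k ih =>
    intro β γ hβ h
    have r1 := sinI_rec γ hβ
    have r2 := sinR_rec γ hβ
    rw [ih (β + 2) γ (by linarith) (by push_cast at h; linarith), ← r2] at r1
    have c2 : ((β : ℂ) + 1) ≠ 0 := by
      have : β + 1 ≠ 0 := by linarith
      exact_mod_cast this
    exact mul_left_cancel₀ c2 r1

/-- The classical identity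
`∫₀^π (sin η)^β e^{iγη} dη = π e^{iγπ/2} Γ(β+1) / (2^β Γ(1+(β+γ)/2) Γ(1+(β-γ)/2))`. -/
theorem stmt_16 (β γ : ℝ) (hβ : -1 < β) :
    (∫ η in (0:ℝ)..π, ((Real.sin η ^ β : ℝ) : ℂ) * Complex.exp (Complex.I * γ * η))
      = (π : ℂ) * Complex.exp (Complex.I * γ * π / 2) * Complex.Gamma ((β : ℂ) + 1)
        / ((((2:ℝ) ^ β : ℝ) : ℂ) * Complex.Gamma (1 + ((β : ℂ) + γ) / 2)
            * Complex.Gamma (1 + ((β : ℂ) - γ) / 2)) := by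
  obtain ⟨n, hn⟩ := exists_nat_ge (2 + |γ|)
  have := abs_nonneg γ
  exact sin_all n β γ hβ (by linarith)
end
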